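/- arXiv:1107.3494 — 9 statements merged into one kernel-verified Lean document; each statement's English description precedes it below -/
import Mathlib

section
/- For any partition of the natural numbers into two cells ℕ = A ∪ B, either A or B contains infinitely many exponential triples; that is, there exist infinitely many triples (a, b, c) of natural numbers with a > 1, b > 1, a^b = c, and a, b, c all lying in the same cell of the partition. -/
/-- An exponential triple is `(a, b, c)` with `a > 1`, `b > 1`, `a ^ b = c`. -/
def ExpTriple (p : ℕ × ℕ × ℕ) : Prop :=
  1 < p.1 ∧ 1 < p.2.1 ∧ p.1 ^ p.2.1 = p.2.2

/-- A set `C ⊆ ℕ` contains the exponential triple `(a, b, c)` if `a, b, c ∈ C`. -/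
def ContainsTriple (C : Set ℕ) (p : ℕ × ℕ × ℕ) : Prop :=
  p.1 ∈ C ∧ p.2.1 ∈ C ∧ p.2.2 ∈ C

/-- In any two-colouring of `ℕ` there is a monochromatic exponential triple whose base is
at least `g`. Multiplying the exponent of a power of `g` by some `b` of the same colour must switch
its colour if there is no such triple, so the product of two numbers of different colours can have
neither colour. -/
theorem exists_expTriple_ge (A : Set ℕ) {g : ℕ} (hg : 2 ≤ g) :
    ∃ p, ExpTriple p ∧ g ≤ p.1 ∧ (ContainsTriple A p ∨ ContainsTriple Aᶜ p) := by
  by_contra! h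
  have hpow : ∀ x, 1 ≤ x → g ≤ g ^ x := fun x hx => Nat.le_self_pow (by omega) g
  have key : ∀ x b, 1 ≤ x → 2 ≤ b →
      (g ^ x ∈ A → b ∈ A → g ^ (x * b) ∉ A) ∧ (g ^ x ∉ A → b ∉ A → g ^ (x * b) ∈ A) := by
    intro x b hx hb
    have hgx := hpow x hx
    have hno := h (g ^ x, b, g ^ (x * b)) ⟨by simp only; omega, hb, (pow_mul g x b).symm⟩ hgx
    simp only [ContainsTriple, Set.mem_compl_iff] at hno
    tauto
  obtain ⟨x, hx, hxA⟩ : ∃ x, 1 ≤ x ∧ g ^ x ∈ A := by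
    by_contra! hA
    have hgA : g ∉ A := by simpa using hA 1 le_rfl
    exact hA (1 * g) (by omega) ((key 1 g le_rfl hg).2 (hA 1 le_rfl) hgA)
  obtain ⟨y, hy, hyA⟩ : ∃ y, 1 ≤ y ∧ g ^ y ∉ A := by
    by_contra! hA
    have hgA : g ∈ A := by simpa using hA 1 le_rfl
    exact (key 1 g le_rfl hg).1 (hA 1 le_rfl) hgA (hA (1 * g) (by omega))
  have hb : 2 ≤ g ^ x := hg.trans (hpow x hx)
  have hc : 2 ≤ g ^ y := hg.trans (hpow y hy)
  have hbc : 2 ≤ g ^ x * g ^ y := by nlinarith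
  have hx' : 1 ≤ x * g ^ x := by nlinarith
  have hy' : 1 ≤ y * g ^ y := by nlinarith
  have hxbc : g ^ (x * (g ^ x * g ^ y)) ∈ A := by
    rw [← mul_assoc]
    exact (key _ _ hx' hc).2 ((key _ _ hx hb).1 hxA hxA) hyA
  have hybc : g ^ (y * (g ^ x * g ^ y)) ∉ A := by
    rw [mul_comm (g ^ x), ← mul_assoc]
    exact (key _ _ hy' hb).1 ((key _ _ hy hc).2 hyA hyA) hxA
  by_cases hmem : g ^ x * g ^ y ∈ A
  · exact (key _ _ hx hbc).1 hxA hmem hxbc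
  · exact hybc ((key _ _ hy hbc).2 hyA hmem)

/-- For any partition `ℕ = A ∪ B`, either `A` or `B` contains infinitely many
exponential triples. -/
theorem exp_triples_partition (A B : Set ℕ) (hpart : A ∪ B = Set.univ) :
    {p : ℕ × ℕ × ℕ | ExpTriple p ∧ ContainsTriple A p}.Infinite ∨
    {p : ℕ × ℕ × ℕ | ExpTriple p ∧ ContainsTriple B p}.Infinite := by
  by_contra! hfin
  obtain ⟨hA, hB⟩ := hfin
  obtain ⟨N, hN⟩ := ((hA.union hB).image Prod.fst).bddAbove
  obtain ⟨p, hp, hle, hmono⟩ := exists_expTriple_ge A (g := N + 2) (by omega)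
  have hAB : Aᶜ ⊆ B := Set.compl_subset_iff_union.mpr hpart
  have hpN : p.1 ≤ N := hN ⟨p, hmono.imp (fun h => ⟨hp, h⟩)
    (fun h => ⟨hp, hAB h.1, hAB h.2.1, hAB h.2.2⟩), rfl⟩
  omega
end

section
/- There exists an ultrafilter 𝒰 on ℕ such that every set U ∈ 𝒰 contains arbitrarily long non-trivial geometric progressions; that is, for every U ∈ 𝒰 and every k ∈ ℕ there exist a > 0 and h > 1 such that a, a·h, a·h², …, a·h^k all belong to U. -/
/-- Van der Waerden's theorem, read in the exponents of the powers of two: every finite colouring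
of the naturals has arbitrarily long monochromatic non-trivial geometric progressions. -/
theorem exists_mono_geometric_progression {κ : Type*} [Finite κ] (C : ℕ → κ) (k : ℕ) :
    ∃ a h : ℕ, 0 < a ∧ 1 < h ∧ ∃ c, ∀ i ≤ k, C (a * h ^ i) = c := by
  obtain ⟨d, hd, b, c, hc⟩ :=
    Combinatorics.exists_mono_homothetic_copy (Finset.range (k + 1)) fun n ↦ C (2 ^ n)
  refine ⟨2 ^ b, 2 ^ d, by positivity, Nat.one_lt_two_pow hd.ne', c, fun i hi ↦ ?_⟩
  rw [← hc i (Finset.mem_range.2 (Nat.lt_succ_of_le hi)), smul_eq_mul, ← pow_mul, ← pow_add,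
    add_comm]

/-- There exists an ultrafilter `𝒰` on `ℕ` such that every `U ∈ 𝒰` contains
arbitrarily long non-trivial geometric progressions. -/
theorem exists_ultrafilter_geometric_progressions :
    ∃ 𝒰 : Ultrafilter ℕ, ∀ U ∈ 𝒰, ∀ k : ℕ,
      ∃ a h : ℕ, 0 < a ∧ 1 < h ∧ ∀ i ≤ k, a * h ^ i ∈ U := by
  let S : Set (Set ℕ) :=
    {s | ∃ k : ℕ, ∀ a h : ℕ, 0 < a → 1 < h → ∃ i ≤ k, a * h ^ i ∈ s}
  obtain ⟨𝒰, h𝒰⟩ := Ultrafilter.exists_ultrafilter_of_finite_inter_nonempty S (by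
    intro T hT
    by_contra hempty
    have hcover (n : ℕ) : ∃ t : T, n ∉ (t : Set ℕ) := by
      by_contra! hn
      exact hempty ⟨n, fun t ht ↦ hn ⟨t, ht⟩⟩
    choose C hC using hcover
    choose k hk using fun t : T ↦ hT t.2
    obtain ⟨a, h, ha, hh, c, hc⟩ := exists_mono_geometric_progression C (Finset.univ.sup k)
    obtain ⟨i, hi, hmem⟩ := hk c a h ha hh
    have hnot := hC (a * h ^ i)
    rw [hc i (hi.trans (Finset.le_sup (Finset.mem_univ c)))] at hnot
    exact hnot hmem)
  refine ⟨𝒰, fun U hU k ↦ ?_⟩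
  by_contra! hk
  exact Ultrafilter.compl_notMem_iff.2 hU (h𝒰 ⟨k, hk⟩)
end

section
/- For any partition of ℕ into finitely many cells, one of the cells contains arbitrarily long non-trivial geometric progressions; that is, there is a cell C such that for every k ∈ ℕ there exist a > 0 and h > 1 with a, a·h, a·h², …, a·h^k all belonging to C. -/
/-- For any partition of `ℕ` into finitely many cells, one of the cells contains
arbitrarily long non-trivial geometric progressions. -/
theorem vdW_geometric {ι : Type*} [Finite ι] (C : ι → Set ℕ)
    (hpart : (⋃ i, C i) = Set.univ) :
    ∃ i : ι, ∀ k : ℕ, ∃ a h : ℕ, 0 < a ∧ 1 < h ∧ ∀ j ≤ k, a * h ^ j ∈ C i := by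
  by_contra! hfail
  choose len hlen using hfail
  have hcover : ∀ n : ℕ, ∃ i, 2 ^ n ∈ C i := fun n =>
    Set.mem_iUnion.mp (hpart ▸ Set.mem_univ (2 ^ n))
  choose color hcolor using hcover
  obtain ⟨K, hK⟩ := (Set.finite_range len).bddAbove
  obtain ⟨d, hd, b, i, hmono⟩ :=
    Combinatorics.exists_mono_homothetic_copy (Finset.range (K + 1)) color
  obtain ⟨j, hj, hnot⟩ := hlen i (2 ^ b) (2 ^ d) (by positivity) (Nat.one_lt_two_pow hd.ne')
  have hjK : j ≤ K := hj.trans (hK ⟨i, rfl⟩)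
  apply hnot
  have hmem := hcolor (d • j + b)
  rwa [hmono j (Finset.mem_range.mpr (by omega)), smul_eq_mul, pow_add, pow_mul, mul_comm] at hmem
end

section
/- Let A ⊆ ℕ be a multiplicative IP* set and let n ∈ ℕ with n ≥ 2. Then log_n[A] = {m ∈ ℕ : n^m ∈ A} is an additive IP* set. -/
/-- The set of finite sums of distinct elements of `X`. -/
def FS (X : Set ℕ) : Set ℕ :=
  {n | ∃ F : Finset ℕ, F.Nonempty ∧ ↑F ⊆ X ∧ ∑ i ∈ F, i = n}

/-- The set of finite products of distinct elements of `X`. -/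
def FP (X : Set ℕ) : Set ℕ :=
  {n | ∃ F : Finset ℕ, F.Nonempty ∧ ↑F ⊆ X ∧ ∏ i ∈ F, i = n}

/-- `C` is an additive IP set if it contains `FS X` for some infinite `X`. -/
def AddIP (C : Set ℕ) : Prop := ∃ X : Set ℕ, X.Infinite ∧ FS X ⊆ C

/-- `C` is a multiplicative IP set if it contains `FP X` for some infinite `X`. -/
def MulIP (C : Set ℕ) : Prop := ∃ X : Set ℕ, X.Infinite ∧ FP X ⊆ C

/-- `A` is an additive IP* set if its complement is not an additive IP set. -/
def AddIPStar (A : Set ℕ) : Prop := ¬ AddIP Aᶜ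

/-- `A` is a multiplicative IP* set if its complement is not a multiplicative IP set. -/
def MulIPStar (A : Set ℕ) : Prop := ¬ MulIP Aᶜ

/-- If `A` is a multiplicative IP* set and `n ≥ 2`, then `log_n[A] = {m : n ^ m ∈ A}`
is an additive IP* set. -/
theorem log_of_mulIPStar (A : Set ℕ) (hA : MulIPStar A) (n : ℕ) (hn : 2 ≤ n) :
    AddIPStar {m : ℕ | n ^ m ∈ A} := by
  rintro ⟨X, hX, hFS⟩
  have hinj : Function.Injective (n ^ · : ℕ → ℕ) := Nat.pow_right_injective hn
  refine hA ⟨(n ^ ·) '' X, hX.image hinj.injOn, ?_⟩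
  rintro _ ⟨F, hF, hFX, rfl⟩
  obtain ⟨G, hGX, rfl⟩ := Finset.subset_set_image_iff.mp hFX
  rw [Finset.prod_image hinj.injOn, Finset.prod_pow_eq_pow_sum]
  exact hFS ⟨G, Finset.image_nonempty.mp hF, hGX, rfl⟩
end

section
/- Let A ⊆ ℕ be a multiplicative IP* set and let n ∈ ℕ with n ≥ 1. Then A^{1/n} = {m ∈ ℕ : m^n ∈ A} is a multiplicative IP* set. -/
/-- If `A` is a multiplicative IP* set and `n ≥ 1`, then `A^{1/n} = {m : m ^ n ∈ A}`
is a multiplicative IP* set. -/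
theorem root_of_mulIPStar (A : Set ℕ) (hA : MulIPStar A) (n : ℕ) (hn : 1 ≤ n) :
    MulIPStar {m : ℕ | m ^ n ∈ A} := by
  rintro ⟨X, hX, hFP⟩
  have hinj : Function.Injective (fun m : ℕ => m ^ n) :=
    Nat.pow_left_injective (by omega)
  refine hA ⟨(fun m : ℕ => m ^ n) '' X, hX.image hinj.injOn, ?_⟩
  rintro _ ⟨F, hF, hFX, rfl⟩
  obtain ⟨G, hGX, rfl⟩ := Finset.subset_set_image_iff.mp hFX
  rw [Finset.prod_image hinj.injOn, Finset.prod_pow]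
  exact hFP ⟨G, Finset.image_nonempty.mp hF, hGX, rfl⟩
end

section
/- For any multiplicative IP* set A ⊆ ℕ there exist infinite sets X, Y ⊆ ℕ such that FS(X) ⊆ A, FE^I(X) ⊆ A, FP(Y) ⊆ A, and FE^II(Y) ⊆ A. -/
/-- `FE^I_n` for the sequence `x`:  `FE^I_0 = {x 0}` and
`FE^I_{n+1} = {y ^ x (n+1) : y ∈ FE^I_n} ∪ FE^I_n ∪ {x (n+1)}`. -/
def FEIn (x : ℕ → ℕ) : ℕ → Set ℕ
  | 0 => {x 0}
  | n + 1 => (fun y => y ^ x (n + 1)) '' FEIn x n ∪ FEIn x n ∪ {x (n + 1)}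

/-- `FE^II_n` for the sequence `x`:  `FE^II_0 = {x 0}` and
`FE^II_{n+1} = {(x (n+1)) ^ y : y ∈ FE^II_n} ∪ FE^II_n ∪ {x (n+1)}`. -/
def FEIIn (x : ℕ → ℕ) : ℕ → Set ℕ
  | 0 => {x 0}
  | n + 1 => (fun y => x (n + 1) ^ y) '' FEIIn x n ∪ FEIIn x n ∪ {x (n + 1)}

/-- `FE^I(X)`, where `X` is enumerated increasingly by `Nat.nth`. -/
def FEI (X : Set ℕ) : Set ℕ := ⋃ n, FEIn (Nat.nth (· ∈ X)) n

/-- `FE^II(X)`, where `X` is enumerated increasingly by `Nat.nth`. -/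
def FEII (X : Set ℕ) : Set ℕ := ⋃ n, FEIIn (Nat.nth (· ∈ X)) n

open Filter

attribute [local instance] Ultrafilter.semigroup Ultrafilter.addSemigroup

/-- The Ellis lemma for the ultrafilters refining a given filter. -/
@[to_additive]
theorem exists_mul_idempotent_ultrafilter_le {M : Type*} [Semigroup M] (F : Filter M) [F.NeBot]
    (hF : ∀ u v : Ultrafilter M, (u : Filter M) ≤ F → (v : Filter M) ≤ F →
      ((u * v : Ultrafilter M) : Filter M) ≤ F) :
    ∃ u : Ultrafilter M, (u : Filter M) ≤ F ∧ u * u = u := by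
  have hclosed : IsClosed {u : Ultrafilter M | (u : Filter M) ≤ F} := by
    have : {u : Ultrafilter M | (u : Filter M) ≤ F} = ⋂ C ∈ F, {u : Ultrafilter M | C ∈ u} := by
      ext u
      simp [Filter.le_def]
    rw [this]
    exact isClosed_biInter fun C _ => ultrafilter_isClosed_basic C
  exact exists_idempotent_in_compact_subsemigroup Ultrafilter.continuous_mul_left _
    ⟨Ultrafilter.of F, Ultrafilter.of_le F⟩ hclosed.isCompact fun u hu v hv => hF u v hu hv

/-- The closure of a sequence under `y ↦ op (x (n + 1)) y`, stage by stage. -/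
def opClosure {M : Type*} (op : M → M → M) (x : ℕ → M) : ℕ → Set M
  | 0 => {x 0}
  | n + 1 => op (x (n + 1)) '' opClosure op x n ∪ opClosure op x n ∪ {x (n + 1)}

theorem FEIn_eq_opClosure (x : ℕ → ℕ) (n : ℕ) :
    FEIn x n = opClosure (fun a y => y ^ a) x n := by
  induction n with
  | zero => rfl
  | succ n ih => rw [FEIn, opClosure, ih]

theorem FEIIn_eq_opClosure (x : ℕ → ℕ) (n : ℕ) :
    FEIIn x n = opClosure (fun a y => a ^ y) x n := by
  induction n with
  | zero => rfl
  | succ n ih => rw [FEIIn, opClosure, ih]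

/-- A member of an idempotent ultrafilter contains all finite products of a strictly increasing
sequence which moreover stays inside the set under an operation whose sections preserve it
almost everywhere. -/
@[to_additive]
theorem exists_strictMono_prod_mem {M : Type*} [CommMonoid M] [Preorder M] (p : Ultrafilter M)
    (hp : p * p = p) (htop : ∀ a, Set.Ioi a ∈ p) (B : Set M) (hB : B ∈ p) (op : M → M → M)
    (hop : ∀ y ∈ B, ∀ᶠ m in (p : Filter M), op m y ∈ B) :
    ∃ x : ℕ → M, StrictMono x ∧ (∀ F : Finset ℕ, F.Nonempty → ∏ i ∈ F, x i ∈ B) ∧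
      ∀ n, opClosure op x n ⊆ B := by
  classical
  have step : ∀ (C : {C : Set M // C ∈ p}) (E : Finset M), ∃ a, a ∈ C.1 ∧
      {m | a * m ∈ C.1} ∈ p ∧ ∀ y ∈ E, y < a ∧ (y ∈ B → op a y ∈ B) := by
    rintro ⟨C, hC⟩ E
    have h1 : ∀ᶠ a in (p : Filter M), ∀ᶠ m in (p : Filter M), a * m ∈ C := by
      rw [← Ultrafilter.eventually_mul, hp]
      exact hC
    have h2 : ∀ᶠ a in (p : Filter M), ∀ y ∈ E, y < a ∧ (y ∈ B → op a y ∈ B) := by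
      rw [Filter.eventually_all_finset]
      intro y _
      refine Filter.Eventually.and (htop y) ?_
      by_cases hy : y ∈ B
      · exact (hop y hy).mono fun _ h _ => h
      · exact Filter.Eventually.of_forall fun _ h => absurd h hy
    have hC' : ∀ᶠ a in (p : Filter M), a ∈ C := hC
    obtain ⟨a, ha, hb, hc⟩ := (hC'.and (h1.and h2)).exists
    exact ⟨a, ha, hb, hc⟩
  choose f hfC hfm hfE using step
  let s : ℕ → {C : Set M // C ∈ p} × Finset M := fun n => Nat.rec (⟨B, hB⟩, ∅) (fun _ t =>
    (⟨t.1.1 ∩ {m | f t.1 t.2 * m ∈ t.1.1}, Filter.inter_mem t.1.2 (hfm t.1 t.2)⟩,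
      t.2.image (op (f t.1 t.2)) ∪ t.2 ∪ {f t.1 t.2})) n
  let x : ℕ → M := fun n => f (s n).1 (s n).2
  have hsC : ∀ n, (s (n + 1)).1.1 = (s n).1.1 ∩ {m | x n * m ∈ (s n).1.1} := fun n => rfl
  have hsE : ∀ n, (s (n + 1)).2 = (s n).2.image (op (x n)) ∪ (s n).2 ∪ {x n} := fun n => rfl
  have hxC : ∀ n, x n ∈ (s n).1.1 := fun n => hfC _ _
  have hxE : ∀ n, ∀ y ∈ (s n).2, y < x n ∧ (y ∈ B → op (x n) y ∈ B) := fun n => hfE _ _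
  have hanti : Antitone fun n => (s n).1.1 :=
    antitone_nat_of_succ_le fun n => by
      rw [hsC]
      exact Set.inter_subset_left
  have hCB : ∀ n, (s n).1.1 ⊆ B := fun n => hanti (Nat.zero_le n)
  have hprod : ∀ F : Finset ℕ, F.Nonempty → ∀ n, (∀ i ∈ F, n ≤ i) →
      ∏ i ∈ F, x i ∈ (s n).1.1 := by
    intro F
    induction F using Finset.induction_on_min with
    | empty => exact fun h => absurd h (by simp)
    | insert a F ha ih =>
      intro _ n hn
      have hna : n ≤ a := hn a (Finset.mem_insert_self a F)
      rw [Finset.prod_insert fun h => (ha a h).false]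
      refine hanti hna ?_
      rcases F.eq_empty_or_nonempty with rfl | hF
      · simpa using hxC a
      · have := ih hF (a + 1) ha
        rw [hsC] at this
        exact this.2
  have hclosure : ∀ n, opClosure op x n ⊆ ((s (n + 1)).2 : Set M) := by
    intro n
    induction n with
    | zero => simp [opClosure, hsE]
    | succ n ih =>
      rw [hsE (n + 1), opClosure]
      push_cast
      gcongr
  refine ⟨x, strictMono_nat_of_lt_succ fun n => ?_, fun F hF => hprod F hF 0 (by simp),
    fun n => ?_⟩
  · exact (hxE (n + 1) (x n) (by simp [hsE])).1
  · induction n with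
    | zero => exact Set.singleton_subset_iff.2 (hCB 0 (hxC 0))
    | succ n ih =>
      rintro _ ((⟨y, hy, rfl⟩ | hy) | rfl)
      · exact (hxE (n + 1) y (hclosure n hy)).2 (ih hy)
      · exact ih hy
      · exact hCB (n + 1) (hxC (n + 1))

theorem FS_range_subset {x : ℕ → ℕ} (hx : Function.Injective x) {B : Set ℕ}
    (h : ∀ F : Finset ℕ, F.Nonempty → ∑ i ∈ F, x i ∈ B) : FS (Set.range x) ⊆ B := by
  rintro _ ⟨F, hF, hFx, rfl⟩
  obtain ⟨G, rfl⟩ : ∃ G : Finset ℕ, G.image x = F := by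
    rw [← Set.image_univ] at hFx
    obtain ⟨G, -, hG⟩ := Finset.subset_set_image_iff.1 hFx
    exact ⟨G, hG⟩
  rw [Finset.sum_image hx.injOn]
  exact h G (Finset.image_nonempty.1 hF)

theorem FP_range_subset {x : ℕ → ℕ} (hx : Function.Injective x) {B : Set ℕ}
    (h : ∀ F : Finset ℕ, F.Nonempty → ∏ i ∈ F, x i ∈ B) : FP (Set.range x) ⊆ B := by
  rintro _ ⟨F, hF, hFx, rfl⟩
  obtain ⟨G, rfl⟩ : ∃ G : Finset ℕ, G.image x = F := by
    rw [← Set.image_univ] at hFx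
    obtain ⟨G, -, hG⟩ := Finset.subset_set_image_iff.1 hFx
    exact ⟨G, hG⟩
  rw [Finset.prod_image hx.injOn]
  exact h G (Finset.image_nonempty.1 hF)

theorem nth_mem_range_of_strictMono {x : ℕ → ℕ} (hx : StrictMono x) :
    Nat.nth (· ∈ Set.range x) = x := by
  have hinf : (Set.range x).Infinite := Set.infinite_range_of_injective hx.injective
  exact ((Nat.nth_strictMono hinf).range_inj hx).1 (Nat.range_nth_of_infinite hinf)

theorem MulIPStar.mem_of_mul_idempotent {A : Set ℕ} (hA : MulIPStar A) {p : Ultrafilter ℕ}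
    (htop : (p : Filter ℕ) ≤ atTop) (hp : p * p = p) : A ∈ p := by
  by_contra h
  obtain ⟨x, hx, hprod, -⟩ := exists_strictMono_prod_mem p hp
    (fun a => htop (Ioi_mem_atTop a)) Aᶜ (Ultrafilter.compl_mem_iff_notMem.2 h) (fun _ y => y)
    (fun y hy => Eventually.of_forall fun _ => hy)
  exact hA ⟨Set.range x, Set.infinite_range_of_injective hx.injective,
    FP_range_subset hx.injective hprod⟩

theorem MulIPStar.eventually_const_pow_mem {A : Set ℕ} (hA : MulIPStar A) {p : Ultrafilter ℕ}
    (htop : (p : Filter ℕ) ≤ atTop) (hp : p + p = p) {y : ℕ} (hy : 2 ≤ y) :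
    ∀ᶠ m in (p : Filter ℕ), y ^ m ∈ A := by
  refine hA.mem_of_mul_idempotent (p := p.map fun m => y ^ m)
    ((tendsto_pow_atTop_atTop_of_one_lt hy).mono_left htop) (Ultrafilter.ext fun C => ?_)
  have h := Ultrafilter.eventually_add p p fun m => y ^ m ∈ C
  rw [hp] at h
  simp only [pow_add] at h
  exact h.symm

theorem MulIPStar.eventually_pow_mem {A : Set ℕ} (hA : MulIPStar A) {p : Ultrafilter ℕ}
    (htop : (p : Filter ℕ) ≤ atTop) (hp : p * p = p) {y : ℕ} (hy : y ≠ 0) :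
    ∀ᶠ m in (p : Filter ℕ), m ^ y ∈ A := by
  refine hA.mem_of_mul_idempotent (p := p.map fun m => m ^ y)
    ((tendsto_pow_atTop hy).mono_left htop) (Ultrafilter.ext fun C => ?_)
  have h := Ultrafilter.eventually_mul p p fun m => m ^ y ∈ C
  rw [hp] at h
  simp only [mul_pow] at h
  exact h.symm

theorem exists_add_idempotent_le_atTop :
    ∃ p : Ultrafilter ℕ, (p : Filter ℕ) ≤ atTop ∧ p + p = p := by
  refine exists_add_idempotent_ultrafilter_le atTop fun u v hu hv C hC => ?_
  obtain ⟨N, hN⟩ := mem_atTop_sets.1 hC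
  exact (Ultrafilter.eventually_add u v (· ∈ C)).2 (Eventually.of_forall fun m =>
    Filter.mem_of_superset (hv (Ici_mem_atTop N)) fun k hk => hN _ (le_add_left hk))

theorem map_const_mul_add_idempotent {p : Ultrafilter ℕ} (hp : p + p = p) (n : ℕ) :
    p.map (n * ·) + p.map (n * ·) = p.map (n * ·) := by
  refine Ultrafilter.ext fun C => ?_
  have h := Ultrafilter.eventually_add p p fun m => n * m ∈ C
  rw [hp] at h
  simp only [mul_add] at h
  exact h.symm

/-- The supremum of the free additive idempotents is refined by a multiplicative idempotent. -/
theorem exists_mul_idempotent_le_iSup_add_idempotent :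
    ∃ q : Ultrafilter ℕ, (q : Filter ℕ) ≤
      ⨆ p ∈ {p : Ultrafilter ℕ | (p : Filter ℕ) ≤ atTop ∧ p + p = p}, (p : Filter ℕ) ∧
      q * q = q := by
  set S := {p : Ultrafilter ℕ | (p : Filter ℕ) ≤ atTop ∧ p + p = p}
  have hne : (⨆ p ∈ S, (p : Filter ℕ)).NeBot := by
    obtain ⟨p, hp⟩ := exists_add_idempotent_le_atTop
    exact p.neBot.mono (le_iSup₂_of_le p hp le_rfl)
  refine exists_mul_idempotent_ultrafilter_le _ fun u v hu hv C hC => ?_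
  have htop : ⨆ p ∈ S, (p : Filter ℕ) ≤ atTop := iSup₂_le fun p hp => hp.1
  refine (Ultrafilter.eventually_mul u v (· ∈ C)).2
    (Filter.mem_of_superset (hu.trans htop (Ioi_mem_atTop 0)) fun n hn => hv ?_)
  simp only [mem_iSup] at hC ⊢
  exact fun p hp => hC (p.map (n * ·))
    ⟨(tendsto_id.const_mul_atTop' hn).mono_left hp.1, map_const_mul_add_idempotent hp.2 n⟩

theorem MulIPStar.exists_mem_add_idempotent {A : Set ℕ} (hA : MulIPStar A) :
    ∃ p : Ultrafilter ℕ, (p : Filter ℕ) ≤ atTop ∧ p + p = p ∧ A ∈ p := by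
  obtain ⟨q, hq, hqq⟩ := exists_mul_idempotent_le_iSup_add_idempotent
  have hAq : A ∈ q := hA.mem_of_mul_idempotent (hq.trans (iSup₂_le fun p hp => hp.1)) hqq
  by_contra! h
  refine Ultrafilter.compl_notMem_iff.2 hAq (hq ?_)
  simp only [mem_iSup]
  exact fun p hp => Ultrafilter.compl_mem_iff_notMem.2 (h p hp.1 hp.2)

theorem exists_mul_idempotent_le_atTop :
    ∃ q : Ultrafilter ℕ, (q : Filter ℕ) ≤ atTop ∧ q * q = q := by
  obtain ⟨q, hq, hqq⟩ := exists_mul_idempotent_le_iSup_add_idempotent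
  exact ⟨q, hq.trans (iSup₂_le fun p hp => hp.1), hqq⟩

/-- For any multiplicative IP* set `A` there exist infinite sets `X, Y ⊆ ℕ` with
`FS(X) ⊆ A`, `FE^I(X) ⊆ A`, `FP(Y) ⊆ A` and `FE^II(Y) ⊆ A`. -/
theorem mulIPStar_exponential_IP (A : Set ℕ) (hA : MulIPStar A) :
    ∃ X Y : Set ℕ, X.Infinite ∧ Y.Infinite ∧
      FS X ⊆ A ∧ FEI X ⊆ A ∧ FP Y ⊆ A ∧ FEII Y ⊆ A := by
  have hpow : ∀ a b : ℕ, 1 < a → 1 < b → 1 < a ^ b := fun a b ha hb =>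
    Nat.one_lt_pow (by lia) ha
  obtain ⟨p, hptop, hpp, hAp⟩ := hA.exists_mem_add_idempotent
  obtain ⟨q, hqtop, hqq⟩ := exists_mul_idempotent_le_atTop
  obtain ⟨x, hx, hsum, hxE⟩ := exists_strictMono_sum_mem p hpp
    (fun a => hptop (Ioi_mem_atTop a)) (A ∩ Set.Ioi 1)
    (inter_mem hAp (hptop (Ioi_mem_atTop 1))) (fun a y => y ^ a) (fun y hy => by
      filter_upwards [hA.eventually_const_pow_mem hptop hpp hy.2, hptop (Ioi_mem_atTop 1)]
        with m hm hm1 using ⟨hm, hpow y m hy.2 hm1⟩)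
  obtain ⟨z, hz, hprod, hzE⟩ := exists_strictMono_prod_mem q hqq
    (fun a => hqtop (Ioi_mem_atTop a)) (A ∩ Set.Ioi 1)
    (inter_mem (hA.mem_of_mul_idempotent hqtop hqq) (hqtop (Ioi_mem_atTop 1)))
    (fun a y => a ^ y) (fun y hy => by
      filter_upwards [hA.eventually_pow_mem hqtop hqq (Nat.ne_zero_of_lt hy.2),
        hqtop (Ioi_mem_atTop 1)] with m hm hm1 using ⟨hm, hpow m y hm1 hy.2⟩)
  refine ⟨Set.range x, Set.range z, Set.infinite_range_of_injective hx.injective,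
    Set.infinite_range_of_injective hz.injective,
    FS_range_subset hx.injective fun F hF => (hsum F hF).1, ?_,
    FP_range_subset hz.injective fun F hF => (hprod F hF).1, ?_⟩
  · rw [FEI, nth_mem_range_of_strictMono hx]
    refine Set.iUnion_subset fun n => ?_
    rw [FEIn_eq_opClosure]
    exact fun _ h => (hxE n h).1
  · rw [FEII, nth_mem_range_of_strictMono hz]
    refine Set.iUnion_subset fun n => ?_
    rw [FEIIn_eq_opClosure]
    exact fun _ h => (hzE n h).1
end

section
/- For any multiplicative IP* set A ⊆ ℕ there exists an infinite set X ⊆ ℕ such that FS(X) ⊆ A and FE^I(X) ⊆ A; in particular, every multiplicative IP* set is both an additive IP set and an exponential IP set of type I. -/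
open Filter

/-- If `U`-almost every `n` extends a good finite set to a good finite set, then there is an
infinite set all of whose finite subsets are good. -/
theorem exists_infinite_forall_finset_subset {U : Filter ℕ} [U.NeBot] (hU : U ≤ cofinite)
    {P : Finset ℕ → Prop} (h_empty : P ∅) (h_anti : ∀ F G, F ⊆ G → P G → P F)
    (h_insert : ∀ F, P F → ∀ᶠ n in U, P (insert n F)) :
    ∃ X : Set ℕ, X.Infinite ∧ ∀ F : Finset ℕ, ↑F ⊆ X → P F := by
  have h_step : ∀ F : {F // P F}, ∃ G : {F // P F}, F.1 ⊂ G.1 := by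
    rintro ⟨F, hF⟩
    have h_new : ∀ᶠ n in U, n ∉ F := hU F.finite_toSet.compl_mem_cofinite
    obtain ⟨n, hn, hnF⟩ := ((h_insert F hF).and h_new).exists
    exact ⟨⟨_, hn⟩, Finset.ssubset_insert hnF⟩
  choose next h_next using h_step
  let S : ℕ → {F // P F} := fun k => next^[k] ⟨∅, h_empty⟩
  have hS : StrictMono fun k => (S k).1 := strictMono_nat_of_lt_succ fun k => by
    simp only [S, Function.iterate_succ_apply']
    exact h_next _
  refine ⟨⋃ k, ↑(S k).1, fun hfin => ?_, fun F hF => ?_⟩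
  · refine Set.infinite_range_of_injective hS.injective
      (hfin.toFinset.powerset.finite_toSet.subset ?_)
    rintro _ ⟨k, rfl⟩
    rw [Finset.mem_coe, Finset.mem_powerset]
    intro n hn
    exact hfin.mem_toFinset.2 (Set.mem_iUnion.2 ⟨k, hn⟩)
  · have h_dir : Directed (· ⊆ ·) fun k => ((S k).1 : Set ℕ) :=
      Monotone.directed_le fun i j hij => Finset.coe_subset.2 (hS.monotone hij)
    obtain ⟨k, hk⟩ := h_dir.exists_mem_subset_of_finset_subset_biUnion hF
    exact h_anti F _ (Finset.coe_subset.1 hk) (S k).2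

theorem MulIP.of_eventually_mul_mem {U : Filter ℕ} [U.NeBot] (hU : U ≤ cofinite) {C : Set ℕ}
    (hC : C ∈ U) (h_mul : ∀ c ∈ C, ∀ᶠ n in U, c * n ∈ C) : MulIP C := by
  obtain ⟨X, hX, hP⟩ := exists_infinite_forall_finset_subset hU
    (P := fun F => ∀ G ⊆ F, G.Nonempty → ∏ i ∈ G, i ∈ C)
    (by simp +contextual [Finset.subset_empty, Finset.not_nonempty_empty])
    (fun F G hFG hG H hH => hG H (hH.trans hFG))
    (fun F hF => by
      have h_prod : ∀ᶠ n in U, ∀ G ∈ F.powerset, G.Nonempty → (∏ i ∈ G, i) * n ∈ C := by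
        rw [Filter.eventually_all_finset]
        intro G hG
        by_cases hne : G.Nonempty
        · filter_upwards [h_mul _ (hF G (Finset.mem_powerset.1 hG) hne)] with n hn _ using hn
        · exact Eventually.of_forall fun _ h => absurd h hne
      filter_upwards [hC, h_prod] with n hnC hn G hG hne
      by_cases hnG : n ∈ G
      · rw [← Finset.prod_erase_mul G _ hnG]
        rcases (G.erase n).eq_empty_or_nonempty with h | h
        · simpa [h] using hnC
        · exact hn _ (Finset.mem_powerset.2 (Finset.subset_insert_iff.1 hG)) h
      · exact hF G ((Finset.subset_insert_iff_of_notMem hnG).1 hG) hne)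
  refine ⟨X, hX, ?_⟩
  rintro _ ⟨F, hne, hF, rfl⟩
  exact hP F hF F subset_rfl hne

/-- `U` is an idempotent of the additive semigroup of ultrafilters on the positive integers. -/
def IsPosAddIdempotent (U : Ultrafilter ℕ) : Prop :=
  (∀ᶠ n in (U : Filter ℕ), n ≠ 0) ∧ ∀ p : ℕ → Prop, (∀ᶠ n in (U : Filter ℕ), p n) →
    ∀ᶠ m in (U : Filter ℕ), ∀ᶠ n in (U : Filter ℕ), p (m + n)

theorem exists_isPosAddIdempotent : ∃ U, IsPosAddIdempotent U := by
  obtain ⟨U, hU, hU_mem⟩ := Hindman.exists_idempotent_ultrafilter_le_FS (Stream'.const 1 : Stream' ℕ)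
  refine ⟨U, hU_mem.mono fun n hn => ?_, fun p hp => ?_⟩
  · have h_pos : ∀ (a : Stream' ℕ) (m : ℕ), Hindman.FS a m → a = Stream'.const 1 → m ≠ 0 := by
      intro a m h
      induction h with
      | head' a => rintro rfl; exact one_ne_zero
      | tail' a m _ ih => rintro rfl; exact ih rfl
      | cons' a m _ ih => rintro rfl; exact fun h => ih rfl (Nat.add_eq_zero_iff.1 h).2
    exact h_pos _ n hn rfl
  · rw [← hU] at hp
    exact hp

namespace IsPosAddIdempotent

variable {U : Ultrafilter ℕ}

theorem le_cofinite (hU : IsPosAddIdempotent U) : (U : Filter ℕ) ≤ cofinite := by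
  rcases U.le_cofinite_or_eq_pure with h | ⟨k, rfl⟩
  · exact h
  · have h_ne : k ≠ 0 := hU.1
    have h_add : k + k = k := hU.2 (· = k) rfl
    omega

theorem map_mul (hU : IsPosAddIdempotent U) {k : ℕ} (hk : k ≠ 0) :
    IsPosAddIdempotent (U.map (k * ·)) := by
  refine ⟨?_, fun p hp => ?_⟩
  · rw [Ultrafilter.coe_map, eventually_map]
    exact hU.1.mono fun n hn => mul_ne_zero hk hn
  · simp only [Ultrafilter.coe_map, eventually_map] at hp ⊢
    simpa only [mul_add] using hU.2 _ hp

theorem eventually_pow_mem (hU : IsPosAddIdempotent U) {A : Set ℕ} (hA : MulIPStar A) {x : ℕ}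
    (hx : 2 ≤ x) : ∀ᶠ n in (U : Filter ℕ), x ^ n ∈ A := by
  by_contra h
  rw [← Ultrafilter.eventually_not] at h
  have h_cofinite : (U.map (x ^ ·) : Filter ℕ) ≤ cofinite :=
    ((Nat.pow_right_injective hx).tendsto_cofinite).mono_left hU.le_cofinite
  obtain ⟨X, hX, hXA⟩ := MulIP.of_eventually_mul_mem h_cofinite
    (C := {b | b ∉ A ∧ ∀ᶠ n in (U : Filter ℕ), b * x ^ n ∉ A})
    (by
      rw [Ultrafilter.coe_map]
      change ∀ᶠ n in (U : Filter ℕ), _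
      simpa only [pow_add] using! h.and (hU.2 _ h))
    (by
      rintro c ⟨-, hc⟩
      rw [Ultrafilter.coe_map, eventually_map]
      simpa only [Set.mem_ofPred_eq, pow_add, mul_assoc] using hc.and (hU.2 _ hc))
  exact hA ⟨X, hX, fun n hn => (hXA hn).1⟩

theorem eventually_pow_mul_mem (hU : IsPosAddIdempotent U) {A : Set ℕ} (hA : MulIPStar A)
    {x k : ℕ} (hx : 2 ≤ x) (hk : k ≠ 0) : ∀ᶠ n in (U : Filter ℕ), x ^ (k * n) ∈ A :=
  (hU.map_mul hk).eventually_pow_mem hA hx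

end IsPosAddIdempotent

theorem MulIPStar.exists_isPosAddIdempotent_mem {A : Set ℕ} (hA : MulIPStar A) :
    ∃ U, IsPosAddIdempotent U ∧ A ∈ U := by
  by_contra! h
  obtain ⟨U, hU⟩ := exists_isPosAddIdempotent
  have h_compl : ∀ V, IsPosAddIdempotent V → ∀ᶠ n in (V : Filter ℕ), n ∉ A := fun V hV =>
    Ultrafilter.eventually_not.2 (h V hV)
  obtain ⟨X, hX, hXA⟩ := MulIP.of_eventually_mul_mem hU.le_cofinite (C := {n | n ∉ A ∧ n ≠ 0})
    ((h_compl U hU).and hU.1) (fun c hc => by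
      have h_map : ∀ᶠ n in (U : Filter ℕ), c * n ∉ A := h_compl _ (hU.map_mul hc.2)
      filter_upwards [h_map, hU.1] with n hn hn0
      exact ⟨hn, mul_ne_zero hc.2 hn0⟩)
  exact hA ⟨X, hX, fun n hn => (hXA hn).1⟩

theorem exists_pow_prod_of_mem_FEIn {x : ℕ → ℕ} (hx : StrictMono x) {n y : ℕ}
    (hy : y ∈ FEIn x n) : ∃ b ∈ Set.range x, ∃ G : Finset ℕ, ↑G ⊆ Set.range x ∧ b ≤ x n ∧
      (∀ g ∈ G, b < g ∧ g ≤ x n) ∧ b ^ ∏ i ∈ G, i = y := by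
  induction n generalizing y with
  | zero =>
    obtain rfl : y = x 0 := hy
    exact ⟨x 0, ⟨0, rfl⟩, ∅, by simp⟩
  | succ n ih =>
    have h_lt : x n < x (n + 1) := hx n.lt_succ_self
    rcases hy with (⟨z, hz, rfl⟩ | hy) | rfl
    · obtain ⟨b, hb, G, hG, hbn, hGn, rfl⟩ := ih hz
      have h_notMem : x (n + 1) ∉ G := fun h => (hGn _ h).2.not_gt h_lt
      refine ⟨b, hb, insert (x (n + 1)) G, ?_, hbn.trans h_lt.le, ?_, ?_⟩
      · rw [Finset.coe_insert]
        exact Set.insert_subset ⟨_, rfl⟩ hG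
      · rw [Finset.forall_mem_insert]
        exact ⟨⟨hbn.trans_lt h_lt, le_rfl⟩, fun g hg => ⟨(hGn g hg).1, (hGn g hg).2.trans h_lt.le⟩⟩
      · rw [Finset.prod_insert h_notMem, mul_comm, pow_mul]
    · obtain ⟨b, hb, G, hG, hbn, hGn, rfl⟩ := ih hy
      exact ⟨b, hb, G, hG, hbn.trans h_lt.le,
        fun g hg => ⟨(hGn g hg).1, (hGn g hg).2.trans h_lt.le⟩, rfl⟩
    · exact ⟨x (n + 1), ⟨_, rfl⟩, ∅, by simp⟩

/-- A finite set is good for `C` and `A` if its subset sums lie in `C` and the powers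
`x ^ ∏ i ∈ G, i`, for an element `x` and a subset `G` of larger elements, lie in `A`. -/
def GoodFinset (C A : Set ℕ) (F : Finset ℕ) : Prop :=
  (∀ G ⊆ F, G.Nonempty → ∑ i ∈ G, i ∈ C) ∧
    ∀ x ∈ F, ∀ G ⊆ F, (∀ g ∈ G, x < g) → x ^ ∏ i ∈ G, i ∈ A

theorem GoodFinset.eventually_insert {U : Ultrafilter ℕ} (hU : IsPosAddIdempotent U)
    {A C : Set ℕ} (hA : MulIPStar A) (hCA : C ⊆ A) (hC_two : ∀ c ∈ C, 2 ≤ c) (hC : C ∈ U)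
    (h_add : ∀ c ∈ C, ∀ᶠ n in (U : Filter ℕ), c + n ∈ C) {F : Finset ℕ}
    (hF : GoodFinset C A F) : ∀ᶠ n in (U : Filter ℕ), GoodFinset C A (insert n F) := by
  have h_two : ∀ x ∈ F, 2 ≤ x := fun x hx => hC_two x <| by
    simpa using hF.1 {x} (Finset.singleton_subset_iff.2 hx) (Finset.singleton_nonempty x)
  have h_sum : ∀ᶠ n in (U : Filter ℕ), ∀ G ∈ F.powerset, G.Nonempty → (∑ i ∈ G, i) + n ∈ C := by
    rw [Filter.eventually_all_finset]
    intro G hG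
    by_cases hne : G.Nonempty
    · filter_upwards [h_add _ (hF.1 G (Finset.mem_powerset.1 hG) hne)] with n hn _ using hn
    · exact Eventually.of_forall fun _ h => absurd h hne
  have h_pow : ∀ᶠ n in (U : Filter ℕ), ∀ x ∈ F, ∀ G ∈ F.powerset, x ^ ((∏ i ∈ G, i) * n) ∈ A := by
    simp only [Filter.eventually_all_finset]
    intro x hx G hG
    refine hU.eventually_pow_mul_mem hA (h_two x hx) (Finset.prod_ne_zero_iff.2 fun i hi => ?_)
    have := h_two i (Finset.mem_powerset.1 hG hi)
    omega
  have h_gt : ∀ᶠ n in (U : Filter ℕ), ∀ x ∈ F, x < n := by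
    rw [Filter.eventually_all_finset]
    intro x _
    exact (Nat.cofinite_eq_atTop ▸ hU.le_cofinite) (eventually_gt_atTop x)
  filter_upwards [hC, h_sum, h_pow, h_gt] with n hnC hn_sum hn_pow hn_gt
  refine ⟨fun G hG hne => ?_, fun x hx G hG hxG => ?_⟩
  · by_cases hnG : n ∈ G
    · rw [← Finset.sum_erase_add G _ hnG]
      rcases (G.erase n).eq_empty_or_nonempty with h | h
      · simpa [h] using hnC
      · exact hn_sum _ (Finset.mem_powerset.2 (Finset.subset_insert_iff.1 hG)) h
    · exact hF.1 G ((Finset.subset_insert_iff_of_notMem hnG).1 hG) hne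
  · rcases Finset.mem_insert.1 hx with rfl | hxF
    · obtain rfl : G = ∅ := Finset.eq_empty_of_forall_notMem fun g hg => by
        have h_lt := hxG g hg
        rcases Finset.mem_insert.1 (hG hg) with rfl | hgF
        · exact h_lt.false
        · exact h_lt.asymm (hn_gt g hgF)
      simpa using hCA hnC
    · by_cases hnG : n ∈ G
      · rw [← Finset.prod_erase_mul G _ hnG]
        exact hn_pow x hxF _ (Finset.mem_powerset.2 (Finset.subset_insert_iff.1 hG))
      · exact hF.2 x hxF G ((Finset.subset_insert_iff_of_notMem hnG).1 hG) hxG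

/-- For any multiplicative IP* set `A` there is an infinite set `X ⊆ ℕ` with
`FS(X) ⊆ A` and `FE^I(X) ⊆ A`; in particular `A` is an additive IP set and an
exponential IP set of type I. -/
theorem mulIPStar_expIP_I (A : Set ℕ) (hA : MulIPStar A) :
    ∃ X : Set ℕ, X.Infinite ∧ FS X ⊆ A ∧ FEI X ⊆ A := by
  obtain ⟨U, hU, hAU⟩ := hA.exists_isPosAddIdempotent_mem
  have h_two : ∀ᶠ n in (U : Filter ℕ), 2 ≤ n :=
    (Nat.cofinite_eq_atTop ▸ hU.le_cofinite) (eventually_ge_atTop 2)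
  let C : Set ℕ := {c | (c ∈ A ∧ 2 ≤ c) ∧ ∀ᶠ n in (U : Filter ℕ), c + n ∈ A ∧ 2 ≤ c + n}
  have h_mem : ∀ᶠ n in (U : Filter ℕ), n ∈ A ∧ 2 ≤ n := Filter.Eventually.and hAU h_two
  have hC : C ∈ U := h_mem.and (hU.2 _ h_mem)
  have h_add : ∀ c ∈ C, ∀ᶠ n in (U : Filter ℕ), c + n ∈ C := by
    rintro c ⟨-, hc⟩
    simpa only [C, Set.mem_ofPred_eq, add_assoc] using hc.and (hU.2 _ hc)
  obtain ⟨X, hX, hP⟩ := exists_infinite_forall_finset_subset hU.le_cofinite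
    (P := GoodFinset C A)
    ⟨fun G hG hne => absurd (Finset.subset_empty.1 hG) hne.ne_empty, by simp⟩
    (fun F G hFG hG => ⟨fun H hH => hG.1 H (hH.trans hFG),
      fun x hx H hH => hG.2 x (hFG hx) H (hH.trans hFG)⟩)
    (fun F hF => hF.eventually_insert hU hA (fun c hc => hc.1.1) (fun c hc => hc.1.2) hC h_add)
  refine ⟨X, hX, ?_, ?_⟩
  · rintro _ ⟨F, hne, hF, rfl⟩
    exact ((hP F hF).1 F subset_rfl hne).1.1
  · refine Set.iUnion_subset fun n y hy => ?_
    obtain ⟨b, hb, G, hG, -, hGb, rfl⟩ :=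
      exists_pow_prod_of_mem_FEIn (x := Nat.nth (· ∈ X)) (Nat.nth_strictMono hX) hy
    have h_range : Set.range (Nat.nth (· ∈ X)) = X := Nat.range_nth_of_infinite hX
    rw [h_range] at hb hG
    refine (hP (insert b G) ?_).2 b (Finset.mem_insert_self b G) G (Finset.subset_insert b G)
      fun g hg => (hGb g hg).1
    rw [Finset.coe_insert]
    exact Set.insert_subset hb hG
end

section
/- For any multiplicative IP* set A ⊆ ℕ there exists an infinite set Y ⊆ ℕ such that FP(Y) ⊆ A and FE^II(Y) ⊆ A; in particular, every multiplicative IP* set is both a multiplicative IP set and an exponential IP set of type II. -/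
open Filter

attribute [local instance] Ultrafilter.mul

/-- There is a nonprincipal idempotent ultrafilter of the multiplicative semigroup `ℕ`. -/
lemma exists_idempotent_ultrafilter_le_cofinite :
    ∃ U : Ultrafilter ℕ, U * U = U ∧ (U : Filter ℕ) ≤ cofinite := by
  obtain ⟨U, hU, hFP⟩ := Hindman.exists_idempotent_ultrafilter_le_FP (fun _ => 2 : Stream' ℕ)
  refine ⟨U, hU, ?_⟩
  have two_le : ∀ (a : Stream' ℕ) m, m ∈ Hindman.FP a → (∀ i, a.get i = 2) → 2 ≤ m := by
    intro a m hm
    induction hm with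
    | head' a => exact fun h => (h 0).ge
    | tail' a m _ ih => exact fun h => ih fun i => h (i + 1)
    | cons' a m _ ih =>
      intro h
      have h0 : a.head = 2 := h 0
      have := ih fun i => h (i + 1)
      rw [h0]
      omega
  have hge : ∀ᶠ m in U, 2 ≤ m := hFP.mono fun m hm => two_le _ m hm fun _ => rfl
  rcases U.le_cofinite_or_eq_pure with h | ⟨a, rfl⟩
  · exact h
  · have ha : 2 ≤ a := by simpa using hge
    have hmul : ∀ᶠ m in ((pure a * pure a : Ultrafilter ℕ) : Filter ℕ), m = a := by
      rw [hU]
      simp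
    rw [Ultrafilter.eventually_mul] at hmul
    have : a * a = a := by simpa using hmul
    nlinarith

/-- Members of a nonprincipal idempotent ultrafilter contain `FP Y` for some infinite `Y`, which
may be chosen so that each element of `Y` lies in prescribed members of the ultrafilter
depending on the smaller elements of `Y`. -/
lemma exists_infinite_FP_subset {U : Ultrafilter ℕ} (hU : U * U = U)
    (hcof : (U : Filter ℕ) ≤ cofinite) {B : Set ℕ} (hB : B ∈ U) (D : ℕ → Set ℕ)
    (hD : ∀ a, D a ∈ U) :
    ∃ Y : Set ℕ, Y.Infinite ∧ 0 ∉ Y ∧ FP Y ⊆ B ∧ ∀ a ∈ Y, ∀ b ∈ Y, a < b → b ∈ D a := by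
  have idem (p : ℕ → Prop) :
      (∀ᶠ m in U, p m) ↔ ∀ᶠ m in U, ∀ᶠ m' in U, p (m * m') := by
    conv_lhs => rw [← hU]
    exact Ultrafilter.eventually_mul U U p
  have hgt (a : ℕ) : ∀ᶠ b in U, a < b :=
    hcof (by simpa [Nat.cofinite_eq_atTop] using eventually_gt_atTop a)
  let S : Set ℕ := {a | a ∈ B ∧ ∀ᶠ b in U, a * b ∈ B}
  have hBe : ∀ᶠ a in U, a ∈ B := hB
  have hSU : ∀ᶠ a in U, a ∈ S := hBe.and ((idem _).1 hBe)
  have hSmul (a : ℕ) (ha : a ∈ S) : ∀ᶠ b in U, a * b ∈ S := by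
    refine ha.2.and ?_
    simpa only [mul_assoc] using (idem _).1 ha.2
  let r : ℕ → ℕ → Prop := fun a b =>
    a < b ∧ b ∈ D a ∧ ∀ c ∈ Set.Iic (∏ i ∈ Finset.Icc 1 a, i), c ∈ S → c * b ∈ S
  have hr (a : ℕ) : ∀ᶠ b in U, r a b := by
    refine (hgt a).and (Eventually.and (hD a) ?_)
    rw [eventually_all_finite (Set.finite_Iic _)]
    exact fun c _ => eventually_imp_distrib_left.2 (hSmul c)
  obtain ⟨x, hxP, hxr⟩ := exists_seq_of_forall_finset_exists (fun b => b ∈ S ∧ 0 < b) r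
    fun s _ => ((hSU.and (hgt 0)).and ((eventually_all_finset s).2 fun a _ => hr a)).exists
  have hmono : StrictMono x := fun m n h => (hxr m n h).1
  have hrel : ∀ a ∈ Set.range x, ∀ b ∈ Set.range x, a < b → r a b := by
    rintro _ ⟨m, rfl⟩ _ ⟨n, rfl⟩ h
    exact hxr m n (hmono.lt_iff_lt.1 h)
  have hpos : ∀ a ∈ Set.range x, 0 < a := by
    rintro _ ⟨m, rfl⟩
    exact (hxP m).2
  refine ⟨Set.range x, Set.infinite_range_of_injective hmono.injective,
    fun h => (hpos 0 h).false, ?_, fun a ha b hb h => (hrel a ha b hb h).2.1⟩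
  have key : ∀ F : Finset ℕ, F.Nonempty → ↑F ⊆ Set.range x → ∏ i ∈ F, i ∈ S := by
    intro F
    induction F using Finset.induction_on_max with
    | empty => simp
    | insert b F hlt ih =>
      intro _ hsub
      rw [Finset.coe_insert, Set.insert_subset_iff] at hsub
      rw [Finset.prod_insert fun h => (hlt b h).false, mul_comm]
      rcases F.eq_empty_or_nonempty with rfl | hne
      · obtain ⟨m, rfl⟩ := hsub.1
        simpa using (hxP m).1
      · have hmax := F.max'_mem hne
        refine (hrel _ (hsub.2 hmax) b hsub.1 (hlt _ hmax)).2.2 _ ?_ (ih hne hsub.2)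
        rw [Set.mem_Iic]
        refine Nat.le_of_dvd (Finset.prod_pos fun i hi => (Finset.mem_Icc.1 hi).1)
          (Finset.prod_dvd_prod_of_subset _ _ _ fun i hi => ?_)
        exact Finset.mem_Icc.2 ⟨hpos i (hsub.2 hi), F.le_max' i hi⟩
  rintro _ ⟨F, hne, hsub, rfl⟩
  exact (key F hne hsub).1

/-- A multiplicative IP* set belongs to every nonprincipal idempotent ultrafilter. -/
lemma MulIPStar.mem_ultrafilter {A : Set ℕ} (hA : MulIPStar A) {U : Ultrafilter ℕ}
    (hU : U * U = U) (hcof : (U : Filter ℕ) ≤ cofinite) : A ∈ U := by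
  by_contra h
  obtain ⟨Y, hY, -, hFP, -⟩ := exists_infinite_FP_subset hU hcof
    (Ultrafilter.compl_mem_iff_notMem.2 h) (fun _ => Set.univ) fun _ => univ_mem
  exact hA ⟨Y, hY, hFP⟩

lemma MulIPStar.preimage_pow {A : Set ℕ} (hA : MulIPStar A) {k : ℕ} (hk : k ≠ 0) :
    MulIPStar ((· ^ k) ⁻¹' A) := by
  rintro ⟨X, hX, hFP⟩
  have hinj : Function.Injective fun m : ℕ => m ^ k := Nat.pow_left_injective hk
  refine hA ⟨(· ^ k) '' X, hX.image hinj.injOn, ?_⟩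
  rintro _ ⟨F, hne, hsub, rfl⟩
  obtain ⟨G, hG, rfl⟩ := Finset.subset_set_image_iff.1 hsub
  rw [Finset.prod_image hinj.injOn, Finset.prod_pow]
  exact hFP ⟨G, Finset.image_nonempty.1 hne, hG, rfl⟩

/-- A tower function bounding the elements of `FEIIn x n` in terms of `x n`. -/
def towerBound : ℕ → ℕ
  | 0 => 1
  | m + 1 => (m + 2) ^ towerBound m

lemma towerBound_monotone : Monotone towerBound :=
  monotone_nat_of_le_succ fun _ => (Nat.lt_pow_self (by omega)).le

lemma lt_towerBound (m : ℕ) : m < towerBound m := by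
  induction m with
  | zero => simp [towerBound]
  | succ m ih => exact (Nat.succ_le_of_lt ih).trans_lt (Nat.lt_pow_self (by omega))

lemma pow_le_towerBound {a b y : ℕ} (hab : a < b) (hy : y ≤ towerBound a) :
    b ^ y ≤ towerBound b := by
  obtain ⟨c, rfl⟩ := Nat.exists_eq_succ_of_ne_zero (Nat.ne_zero_of_lt hab)
  exact (Nat.pow_le_pow_left (Nat.le_succ _) y).trans (Nat.pow_le_pow_right (by omega)
    (hy.trans (towerBound_monotone (Nat.le_of_lt_succ hab))))

lemma FEIIn_subset {A : Set ℕ} {x : ℕ → ℕ} (hx : StrictMono x) (hpos : ∀ n, 0 < x n)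
    (hA : ∀ n, x n ∈ A)
    (hpow : ∀ n y, 0 < y → y ≤ towerBound (x n) → x (n + 1) ^ y ∈ A) (n : ℕ) :
    ∀ y ∈ FEIIn x n, y ∈ A ∧ 0 < y ∧ y ≤ towerBound (x n) := by
  have single (n : ℕ) : x n ∈ A ∧ 0 < x n ∧ x n ≤ towerBound (x n) :=
    ⟨hA n, hpos n, (lt_towerBound _).le⟩
  induction n with
  | zero =>
    rintro _ rfl
    exact single 0
  | succ n ih =>
    have hlt : x n < x (n + 1) := hx n.lt_succ_self
    rintro _ ((⟨y, hy, rfl⟩ | hy) | rfl)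
    · obtain ⟨-, hy0, hyb⟩ := ih y hy
      exact ⟨hpow n y hy0 hyb, pow_pos (hpos _) _, pow_le_towerBound hlt hyb⟩
    · obtain ⟨hyA, hy0, hyb⟩ := ih _ hy
      exact ⟨hyA, hy0, hyb.trans (towerBound_monotone hlt.le)⟩
    · exact single (n + 1)

/-- For any multiplicative IP* set `A` there is an infinite set `Y ⊆ ℕ` with
`FP(Y) ⊆ A` and `FE^II(Y) ⊆ A`; in particular `A` is a multiplicative IP set and an
exponential IP set of type II. -/
theorem mulIPStar_expIP_II (A : Set ℕ) (hA : MulIPStar A) :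
    ∃ Y : Set ℕ, Y.Infinite ∧ FP Y ⊆ A ∧ FEII Y ⊆ A := by
  obtain ⟨U, hU, hcof⟩ := exists_idempotent_ultrafilter_le_cofinite
  obtain ⟨Y, hY, h0, hFP, hD⟩ := exists_infinite_FP_subset hU hcof
    (hA.mem_ultrafilter hU hcof)
    (fun a => ⋂ y ∈ Set.Ioc 0 (towerBound a), (· ^ y) ⁻¹' A)
    fun a => (biInter_mem (Set.finite_Ioc _ _)).2 fun y hy =>
      (hA.preimage_pow hy.1.ne').mem_ultrafilter hU hcof
  refine ⟨Y, hY, hFP, Set.iUnion_subset fun n y hy => ?_⟩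
  have hmem (n : ℕ) : Nat.nth (· ∈ Y) n ∈ Y := Nat.nth_mem_of_infinite hY n
  have hmono : StrictMono (Nat.nth (· ∈ Y)) := Nat.nth_strictMono hY
  refine (FEIIn_subset hmono (fun n => Nat.pos_of_ne_zero fun h => h0 (h ▸ hmem n))
    (fun n => hFP ⟨{Nat.nth (· ∈ Y) n}, by simp, by simpa using hmem n, by simp⟩)
    (fun n k hk hkb => ?_) n y hy).1
  exact Set.mem_iInter₂.1 (hD _ (hmem n) _ (hmem (n + 1)) (hmono n.lt_succ_self)) k ⟨hk, hkb⟩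
end

section
/- Every multiplicative IP* set A ⊆ ℕ is an additive IP set; that is, there exists an infinite set X ⊆ ℕ such that FS(X) ⊆ A. -/
open Filter Set

/-- Every member of a free idempotent ultrafilter contains all finite products of distinct elements
of some infinite set. -/
@[to_additive]
theorem Ultrafilter.exists_infinite_forall_prod_mem {M : Type*} [CommMonoid M] (U : Ultrafilter M)
    (idem : ∀ s ∈ U, ∀ᶠ m in U, ∀ᶠ m' in U, m * m' ∈ s) (free : ∀ m : M, {m}ᶜ ∈ U)
    {s : Set M} (hs : s ∈ U) :
    ∃ X : Set M, X.Infinite ∧ ∀ F : Finset M, F.Nonempty → ↑F ⊆ X → ∏ i ∈ F, i ∈ s := by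
  classical
  have exists_elem (t : {t // t ∈ U}) : ∃ m ∈ t.1, {m' | m * m' ∈ t.1} ∈ U :=
    ((eventually_mem_set.2 t.2).and (idem t.1 t.2)).exists
  choose elem elem_mem elem_mul using exists_elem
  let next (t : {t // t ∈ U}) : {t // t ∈ U} :=
    ⟨t.1 ∩ {m' | elem t * m' ∈ t.1} ∩ {elem t}ᶜ,
      inter_mem (inter_mem t.2 (elem_mul t)) (free _)⟩
  let S (n : ℕ) : {t // t ∈ U} := next^[n] ⟨s, hs⟩
  have S_succ (n : ℕ) : S (n + 1) = next (S n) := Function.iterate_succ_apply' ..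
  let a (n : ℕ) : M := elem (S n)
  have anti : Antitone fun n ↦ (S n).1 := antitone_nat_of_succ_le fun n ↦ by
    simp only [S_succ]
    exact fun m hm ↦ hm.1.1
  have a_ne {i j : ℕ} (hij : i < j) : a j ≠ a i := by
    have h : a j ∈ (S (i + 1)).1 := anti (Nat.succ_le_of_lt hij) (elem_mem (S j))
    rw [S_succ] at h
    exact h.2
  have a_inj : Function.Injective a := fun i j h ↦ by
    by_contra hne
    rcases lt_or_gt_of_ne hne with hij | hij
    · exact a_ne hij h.symm
    · exact a_ne hij h
  have prod_mem (G : Finset ℕ) : G.Nonempty → ∀ k, (∀ i ∈ G, k ≤ i) →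
      ∏ i ∈ G, a i ∈ (S k).1 := by
    induction G using Finset.induction_on_min with
    | empty => simp
    | insert x G hx ih =>
      intro _ k hk
      apply anti (hk x (Finset.mem_insert_self x G))
      rw [Finset.prod_insert fun h ↦ (hx x h).false]
      rcases G.eq_empty_or_nonempty with rfl | hG
      · simpa using elem_mem (S x)
      · have h := ih hG (x + 1) fun i hi ↦ hx i hi
        rw [S_succ] at h
        exact h.1.2
  refine ⟨range a, infinite_range_of_injective a_inj, fun F hF hFX ↦ ?_⟩
  obtain ⟨G, rfl⟩ : ∃ G : Finset ℕ, G.image a = F := by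
    rw [← image_univ] at hFX
    obtain ⟨G, -, hG⟩ := Finset.subset_set_image_iff.1 hFX
    exact ⟨G, hG⟩
  rw [Finset.prod_image a_inj.injOn]
  exact prod_mem G (Finset.image_nonempty.1 hF) 0 fun i _ ↦ i.zero_le

/-- There is a free additive idempotent ultrafilter on `ℕ`. -/
theorem exists_free_add_idempotent_ultrafilter :
    ∃ U : Ultrafilter ℕ, (∀ s ∈ U, ∀ᶠ m in U, ∀ᶠ m' in U, m + m' ∈ s) ∧ ∀ m : ℕ, {m}ᶜ ∈ U := by
  let : AddSemigroup (Ultrafilter ℕ) := Ultrafilter.addSemigroup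
  have hS : IsClosed (⋂ n : ℕ, {U : Ultrafilter ℕ | Ioi n ∈ U}) :=
    isClosed_iInter fun n ↦ ultrafilter_isClosed_basic _
  obtain ⟨U, hU, idem⟩ : ∃ U ∈ ⋂ n : ℕ, {U : Ultrafilter ℕ | Ioi n ∈ U}, U + U = U := by
    refine exists_idempotent_in_compact_add_subsemigroup
      Ultrafilter.continuous_add_left _ ⟨hyperfilter ℕ, ?_⟩ hS.isCompact ?_
    · exact mem_iInter.2 fun n ↦ Nat.hyperfilter_le_atTop (Ioi_mem_atTop n)
    · intro U hU V hV
      refine mem_iInter.2 fun n ↦ (Ultrafilter.eventually_add U V (· ∈ Ioi n)).2 ?_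
      filter_upwards [mem_iInter.1 hU n] with m hm
      exact Eventually.of_forall fun m' ↦ lt_of_lt_of_le hm (Nat.le_add_right m m')
  refine ⟨U, fun s hs ↦ ?_, fun m ↦ ?_⟩
  · rwa [← idem] at hs
  · filter_upwards [mem_iInter.1 hU m] with x hx using (ne_of_gt hx)

/-- Additive IP sets are preserved by nonzero dilations. -/
theorem exists_infinite_FS_subset_of_mul_mem {A : Set ℕ} {m : ℕ} (hm : m ≠ 0)
    (h : ∃ X : Set ℕ, X.Infinite ∧ FS X ⊆ {n | m * n ∈ A}) :
    ∃ X : Set ℕ, X.Infinite ∧ FS X ⊆ A := by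
  obtain ⟨X, hX, hXA⟩ := h
  have inj : Function.Injective (m * ·) := mul_right_injective₀ hm
  refine ⟨(m * ·) '' X, hX.image inj.injOn, ?_⟩
  rintro _ ⟨F, hF, hFX, rfl⟩
  obtain ⟨G, hG, rfl⟩ := Finset.subset_set_image_iff.1 hFX
  rw [Finset.sum_image inj.injOn, ← Finset.mul_sum]
  exact hXA ⟨G, Finset.image_nonempty.1 hF, hG, rfl⟩

/-- There is a free multiplicative idempotent ultrafilter on `ℕ` all of whose members are additive
IP sets. -/
theorem exists_free_mul_idempotent_ultrafilter_forall_mem_addIP :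
    ∃ U : Ultrafilter ℕ, (∀ s ∈ U, ∀ᶠ m in U, ∀ᶠ m' in U, m * m' ∈ s) ∧ (∀ m : ℕ, {m}ᶜ ∈ U) ∧
      ∀ A ∈ U, ∃ X : Set ℕ, X.Infinite ∧ FS X ⊆ A := by
  let : Semigroup (Ultrafilter ℕ) := Ultrafilter.semigroup
  let S : Set (Ultrafilter ℕ) := {U | ∀ A ∈ U, ∃ X : Set ℕ, X.Infinite ∧ FS X ⊆ A}
  have hS : IsClosed S := by
    have : S = ⋂ (A : Set ℕ) (_ : ¬ ∃ X : Set ℕ, X.Infinite ∧ FS X ⊆ A), {U | Aᶜ ∈ U} := by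
      ext U
      simp only [S, mem_ofPred_eq, mem_iInter, Ultrafilter.compl_mem_iff_notMem]
      exact forall_congr' fun A ↦ not_imp_not.symm
    rw [this]
    exact isClosed_biInter fun A _ ↦ ultrafilter_isClosed_basic _
  have free {U : Ultrafilter ℕ} (hU : U ∈ S) (m : ℕ) : {m}ᶜ ∈ U := by
    rw [Ultrafilter.compl_mem_iff_notMem]
    intro h
    obtain ⟨X, hX, hXm⟩ := hU _ h
    refine hX ((finite_singleton m).subset fun x hx ↦ hXm ⟨{x}, ?_⟩)
    simpa using hx
  obtain ⟨U, hU, idem⟩ : ∃ U ∈ S, U * U = U := by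
    refine exists_idempotent_in_compact_subsemigroup
      Ultrafilter.continuous_mul_left S ?_ hS.isCompact ?_
    · obtain ⟨U, idem, hfree⟩ := exists_free_add_idempotent_ultrafilter
      refine ⟨U, fun A hA ↦ ?_⟩
      obtain ⟨X, hX, hXA⟩ := U.exists_infinite_forall_sum_mem idem hfree hA
      refine ⟨X, hX, ?_⟩
      rintro _ ⟨F, hF, hFX, rfl⟩
      exact hXA F hF hFX
    · intro U hU V hV A hA
      have h : ∀ᶠ m in U, {n | m * n ∈ A} ∈ V := (Ultrafilter.eventually_mul U V (· ∈ A)).1 hA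
      obtain ⟨m, hmV, hm⟩ := (h.and (free hU 0)).exists
      exact exists_infinite_FS_subset_of_mul_mem hm (hV _ hmV)
  refine ⟨U, fun s hs ↦ ?_, free hU, hU⟩
  rwa [← idem] at hs

/-- Every multiplicative IP* set is an additive IP set. -/
theorem mulIPStar_addIP (A : Set ℕ) (hA : MulIPStar A) :
    ∃ X : Set ℕ, X.Infinite ∧ FS X ⊆ A := by
  obtain ⟨U, idem, free, hU⟩ := exists_free_mul_idempotent_ultrafilter_forall_mem_addIP
  refine hU A (by_contra fun hAU ↦ hA ?_)
  obtain ⟨X, hX, hXA⟩ :=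
    U.exists_infinite_forall_prod_mem idem free (Ultrafilter.compl_mem_iff_notMem.2 hAU)
  refine ⟨X, hX, ?_⟩
  rintro _ ⟨F, hF, hFX, rfl⟩
  exact hXA F hF hFX
end
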